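/- For all characters λ, μ : T → k*, there is an isomorphism of kG-modules M(λ) ⊗_k M(μ) ≅ (kG ⊗_{kB} k_{λμ}) ⊕ (kG ⊗_{kT} k_{λ^s μ}), where the left-hand side carries the diagonal G-action, λμ denotes the pointwise product character, and λ^s is the character defined by λ^s(h(t)) = λ(h(t^{-1})). -/

import Mathlib

noncomputable section

open scoped TensorProduct

namespace SL2X

variable (p : ℕ) [Fact p.Prime]

/-- The algebraic closure of the prime field `𝔽_p`. -/
abbrev F : Type := AlgebraicClosure (ZMod p)

/-- `G = SL₂(F)`. -/
abbrev G : Type := Matrix.SpecialLinearGroup (Fin 2) (F p)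

/-- The unipotent element `ε(x) = [[1,x],[0,1]]`. -/
def eps (x : F p) : G p :=
  ⟨!![1, x; 0, 1], by simp [Matrix.det_fin_two_of]⟩

/-- The torus element `h(t) = diag(t, t⁻¹)`. -/
def h (t : (F p)ˣ) : G p :=
  ⟨!![(t : F p), 0; 0, ((t⁻¹ : (F p)ˣ) : F p)], by simp [Matrix.det_fin_two_of]⟩

/-- The Weyl element `s = [[0,1],[-1,0]]`. -/
def sG : G p :=
  ⟨!![0, 1; -1, 0], by simp [Matrix.det_fin_two_of]⟩

/-- The Borel subgroup `B` of upper triangular matrices in `G`. -/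
def B : Subgroup (G p) where
  carrier := {g | (g : Matrix (Fin 2) (Fin 2) (F p)) 1 0 = 0}
  one_mem' := by simp [Matrix.one_apply]
  mul_mem' := by
    intro a b ha hb
    simp only [Set.mem_setOf_eq] at *
    simp [Matrix.mul_apply, Fin.sum_univ_two, ha, hb]
  inv_mem' := by
    intro a ha
    simp only [Set.mem_setOf_eq] at *
    simp [Matrix.SpecialLinearGroup.coe_inv, Matrix.adjugate_fin_two, ha]

/-- The diagonal part of an element of `B`, as a unit of `F`. -/
def Bdiag (b : B p) : (F p)ˣ where
  val := ((b : G p) : Matrix (Fin 2) (Fin 2) (F p)) 0 0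
  inv := ((b : G p) : Matrix (Fin 2) (Fin 2) (F p)) 1 1
  val_inv := by
    have hdet : ((b : G p) : Matrix (Fin 2) (Fin 2) (F p)).det = 1 := (b : G p).2
    have h10 : ((b : G p) : Matrix (Fin 2) (Fin 2) (F p)) 1 0 = 0 := b.2
    rw [Matrix.det_fin_two, h10, mul_zero, sub_zero] at hdet
    exact hdet
  inv_val := by
    have hdet : ((b : G p) : Matrix (Fin 2) (Fin 2) (F p)).det = 1 := (b : G p).2
    have h10 : ((b : G p) : Matrix (Fin 2) (Fin 2) (F p)) 1 0 = 0 := b.2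
    rw [Matrix.det_fin_two, h10, mul_zero, sub_zero] at hdet
    rw [mul_comm]; exact hdet

variable (k : Type) [Field k] [IsAlgClosed k] [CharZero k]

/-- The group algebra `kG`. -/
abbrev kG : Type := MonoidAlgebra k (G p)

/-- The canonical image of a group element in the group algebra. -/
def γ (g : G p) : kG p k := MonoidAlgebra.of k (G p) g

/-- The submodule of relations defining the induced module
`M(θ) = kG ⊗_{kB} k_θ`, where the character `θ` of `T ≅ Fˣ` is extended to `B`
by letting `U` act trivially. -/
def Nmod (θ : (F p)ˣ →* kˣ) : Submodule (kG p k) (kG p k) :=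
  Submodule.span (kG p k)
    {y | ∃ b : B p, y = γ p k (b : G p) - ((θ (Bdiag p b) : k)) • (1 : kG p k)}

/-- The induced module `M(θ) = kG ⊗_{kB} k_θ`, realized as `kG / N(θ)` where
`N(θ)` is the left submodule generated by the elements `b - θ(b)·1`, `b ∈ B`. -/
def Mmod (θ : (F p)ˣ →* kˣ) : Type := kG p k ⧸ Nmod p k θ

instance (θ : (F p)ˣ →* kˣ) : AddCommGroup (Mmod p k θ) :=
  inferInstanceAs (AddCommGroup (kG p k ⧸ Nmod p k θ))
instance (θ : (F p)ˣ →* kˣ) : Module (kG p k) (Mmod p k θ) :=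
  inferInstanceAs (Module (kG p k) (kG p k ⧸ Nmod p k θ))
instance (θ : (F p)ˣ →* kˣ) : Module k (Mmod p k θ) :=
  inferInstanceAs (Module k (kG p k ⧸ Nmod p k θ))
instance (θ : (F p)ˣ →* kˣ) : IsScalarTower k (kG p k) (Mmod p k θ) :=
  inferInstanceAs (IsScalarTower k (kG p k) (kG p k ⧸ Nmod p k θ))

/-- The canonical generator `1_θ ∈ M(θ)`. -/
def oneθ (θ : (F p)ˣ →* kˣ) : Mmod p k θ :=
  Submodule.Quotient.mk (1 : kG p k)

/-- `η = (1 - s)·1_tr ∈ M(tr)`. -/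
def eta : Mmod p k 1 :=
  Submodule.Quotient.mk ((1 : kG p k) - γ p k (sG p))

/-- The Steinberg module `St = kG·η ⊆ M(tr)`. -/
def St : Submodule (kG p k) (Mmod p k 1) :=
  Submodule.span (kG p k) {eta p k}

/-- `ε(x)·η` as an element of `St`. -/
def E (x : F p) : ↥(St p k) :=
  ⟨γ p k (eps p x) • eta p k,
    Submodule.smul_mem _ _ (Submodule.mem_span_singleton_self _)⟩

/-- The action of a group element on `St`, as a `k`-linear map. -/
def gSt (g : G p) : ↥(St p k) →ₗ[k] ↥(St p k) where
  toFun v := ⟨γ p k g • (v : Mmod p k 1), Submodule.smul_mem _ _ v.2⟩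
  map_add' := by intro a b; apply Subtype.ext; simp [smul_add]
  map_smul' := by
    intro c v; apply Subtype.ext
    simp [smul_comm (γ p k g) c]

/-- `St ⊗_k St`. -/
abbrev StT : Type := ↥(St p k) ⊗[k] ↥(St p k)

/-- The diagonal action of a group element on `St ⊗_k St`. -/
def gTT (g : G p) : StT p k →ₗ[k] StT p k :=
  TensorProduct.map (gSt p k g) (gSt p k g)

/-- `ω_{x,y} = (ε(x)η ⊗ ε(y)η + ε(y)η ⊗ ε(x)η)/2`. -/
def ω (x y : F p) : StT p k :=
  (2 : k)⁻¹ • (E p k x ⊗ₜ[k] E p k y + E p k y ⊗ₜ[k] E p k x)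

/-- `ρ_{x,y} = (ε(x)η ⊗ ε(y)η − ε(y)η ⊗ ε(x)η)/2`. -/
def ρ (x y : F p) : StT p k :=
  (2 : k)⁻¹ • (E p k x ⊗ₜ[k] E p k y - E p k y ⊗ₜ[k] E p k x)

/-- `V₊`, the span of the `ω_{x,y}`. -/
def Vplus : Submodule k (StT p k) :=
  Submodule.span k {v | ∃ x y : F p, v = ω p k x y}

/-- `V₋`, the span of the `ρ_{x,y}` for `x ≠ y`. -/
def Vminus : Submodule k (StT p k) :=
  Submodule.span k {v | ∃ x y : F p, x ≠ y ∧ v = ρ p k x y}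


/-- The relations defining the module `kG ⊗_{kT} k_θ` induced from the torus. -/
def NT (θ : (F p)ˣ →* kˣ) : Submodule (kG p k) (kG p k) :=
  Submodule.span (kG p k)
    {y | ∃ t : (F p)ˣ, y = γ p k (h p t) - ((θ t : k)) • (1 : kG p k)}

/-- The induced module `kG ⊗_{kT} k_θ`, realized as `kG / N_T(θ)`. -/
def MT (θ : (F p)ˣ →* kˣ) : Type := kG p k ⧸ NT p k θ

instance (θ : (F p)ˣ →* kˣ) : AddCommGroup (MT p k θ) :=
  inferInstanceAs (AddCommGroup (kG p k ⧸ NT p k θ))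
instance (θ : (F p)ˣ →* kˣ) : Module (kG p k) (MT p k θ) :=
  inferInstanceAs (Module (kG p k) (kG p k ⧸ NT p k θ))
instance (θ : (F p)ˣ →* kˣ) : Module k (MT p k θ) :=
  inferInstanceAs (Module k (kG p k ⧸ NT p k θ))
instance (θ : (F p)ˣ →* kˣ) : IsScalarTower k (kG p k) (MT p k θ) :=
  inferInstanceAs (IsScalarTower k (kG p k) (kG p k ⧸ NT p k θ))

/-- The action of a group element on `M(θ)`, as a `k`-linear map. -/
def gM (θ : (F p)ˣ →* kˣ) (g : G p) : Mmod p k θ →ₗ[k] Mmod p k θ where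
  toFun m := γ p k g • m
  map_add' := by intro a b; simp [smul_add]
  map_smul' := by intro c m; simp [smul_comm (γ p k g) c]

section CyclicQuotient

variable {k Γ ι V : Type*} [Field k] [Group Γ] [AddCommGroup V] [Module k V]
  {j : ι → Γ} {χ : ι → k}

/-- The left submodule of `kΓ` generated by the elements `j i - χ i · 1`. -/
abbrev relSpan (j : ι → Γ) (χ : ι → k) : Submodule (MonoidAlgebra k Γ) (MonoidAlgebra k Γ) :=
  Submodule.span (MonoidAlgebra k Γ)
    {y | ∃ i, y = MonoidAlgebra.of k Γ (j i) - χ i • (1 : MonoidAlgebra k Γ)}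

/-- The `k`-linear extension to `kΓ` of a function on `Γ`. -/
def linExt (f : Γ → V) : MonoidAlgebra k Γ →ₗ[k] V := (MonoidAlgebra.basis Γ k).constr k f

@[simp]
lemma linExt_of (f : Γ → V) (g : Γ) : linExt (k := k) f (MonoidAlgebra.of k Γ g) = f g := by
  have := (MonoidAlgebra.basis Γ k).constr_basis k f g
  rwa [MonoidAlgebra.basis_apply] at this

lemma linExt_eq_zero (f : Γ → V) (hf : ∀ g i, f (g * j i) = χ i • f g)
    {y : MonoidAlgebra k Γ} (hy : y ∈ relSpan j χ) : linExt f y = 0 := by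
  suffices ∀ a : MonoidAlgebra k Γ, linExt f (a * y) = 0 by simpa using this 1
  induction hy using Submodule.span_induction with
  | mem y hy =>
    obtain ⟨i, rfl⟩ := hy
    intro a
    induction a using MonoidAlgebra.induction_on with
    | of g => rw [mul_sub, ← map_mul, mul_smul_comm, mul_one, map_sub, map_smul, linExt_of,
        linExt_of, hf, sub_self]
    | add a b ha hb => rw [add_mul, map_add, ha, hb, add_zero]
    | smul r a ha => rw [smul_mul_assoc, map_smul, ha, smul_zero]
  | zero => simp
  | add x y _ _ hx hy => intro a; rw [mul_add, map_add, hx, hy, add_zero]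
  | smul r x _ hx => intro a; rw [smul_eq_mul, ← mul_assoc, hx]

/-- The `k`-linear map on `kΓ / relSpan j χ` induced by a function `f` on `Γ` satisfying
`f (g * j i) = χ i • f g`. -/
def quotLift (f : Γ → V) (hf : ∀ g i, f (g * j i) = χ i • f g) :
    (MonoidAlgebra k Γ ⧸ relSpan j χ) →ₗ[k] V :=
  ((relSpan j χ).restrictScalars k).liftQ (linExt f) (fun _ hy => linExt_eq_zero f hf hy) ∘ₗ
    (Submodule.Quotient.restrictScalarsEquiv k (relSpan j χ)).symm.toLinearMap

lemma quotLift_of (f : Γ → V) (hf : ∀ g i, f (g * j i) = χ i • f g) (g : Γ) :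
    quotLift f hf (Submodule.Quotient.mk (MonoidAlgebra.of k Γ g)) = f g :=
  linExt_of f g

lemma quot_hom_ext {L L' : (MonoidAlgebra k Γ ⧸ relSpan j χ) →ₗ[k] V}
    (hL : ∀ g, L (Submodule.Quotient.mk (MonoidAlgebra.of k Γ g)) =
      L' (Submodule.Quotient.mk (MonoidAlgebra.of k Γ g))) : L = L' := by
  refine LinearMap.ext fun x => ?_
  induction x using Submodule.Quotient.induction_on with | _ a
  induction a using MonoidAlgebra.induction_on with
  | of g => exact hL g
  | add a b ha hb => rw [Submodule.Quotient.mk_add, map_add, map_add, ha, hb]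
  | smul r a ha => rw [Submodule.Quotient.mk_smul, map_smul, map_smul, ha]

end CyclicQuotient

section Induced

variable {p k}

omit [IsAlgClosed k] [CharZero k]

variable {V : Type*} [AddCommGroup V] [Module k V] {θ : (F p)ˣ →* kˣ}

variable (θ) in
/-- The vector `g · 1_θ` of `M(θ)`. -/
def mB (g : G p) : Mmod p k θ := Submodule.Quotient.mk (γ p k g)

variable (θ) in
/-- The vector `g · 1_θ` of `kG ⊗_{kT} k_θ`. -/
def mT (g : G p) : MT p k θ := Submodule.Quotient.mk (γ p k g)

lemma γ_mul (g g' : G p) : γ p k (g * g') = γ p k g * γ p k g' := map_mul _ _ _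

lemma γ_smul_mB (g g' : G p) : γ p k g • mB θ g' = mB θ (g * g') := by
  rw [mB, mB, γ_mul]; rfl

lemma γ_smul_mT (g g' : G p) : γ p k g • mT θ g' = mT θ (g * g') := by
  rw [mT, mT, γ_mul]; rfl

lemma gM_mB (g g' : G p) : gM p k θ g (mB θ g') = mB θ (g * g') := γ_smul_mB g g'

lemma mB_mul (g : G p) (b : B p) : mB θ (g * b) = (θ (Bdiag p b) : k) • mB θ g := by
  refine (Submodule.Quotient.eq _).2 ?_
  have : γ p k (g * b) - (θ (Bdiag p b) : k) • γ p k g =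
      γ p k g • (γ p k b - (θ (Bdiag p b) : k) • (1 : kG p k)) := by
    rw [γ_mul, smul_eq_mul, mul_sub, mul_smul_comm, mul_one]
  exact this ▸ Submodule.smul_mem _ _ (Submodule.subset_span ⟨b, rfl⟩)

lemma mT_mul (g : G p) (t : (F p)ˣ) : mT θ (g * h p t) = (θ t : k) • mT θ g := by
  refine (Submodule.Quotient.eq _).2 ?_
  have : γ p k (g * h p t) - (θ t : k) • γ p k g =
      γ p k g • (γ p k (h p t) - (θ t : k) • (1 : kG p k)) := by
    rw [γ_mul, smul_eq_mul, mul_sub, mul_smul_comm, mul_one]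
  exact this ▸ Submodule.smul_mem _ _ (Submodule.subset_span ⟨t, rfl⟩)

/-- The `k`-linear map on `M(θ)` induced by a `θ`-equivariant function on `G`. -/
def liftB (f : G p → V) (hf : ∀ g (b : B p), f (g * b) = (θ (Bdiag p b) : k) • f g) :
    Mmod p k θ →ₗ[k] V :=
  quotLift (j := fun b : B p => (b : G p)) (χ := fun b => (θ (Bdiag p b) : k)) f hf

/-- The `k`-linear map on `kG ⊗_{kT} k_θ` induced by a `θ`-equivariant function on `G`. -/
def liftT (f : G p → V) (hf : ∀ g t, f (g * h p t) = (θ t : k) • f g) :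
    MT p k θ →ₗ[k] V :=
  quotLift (j := h p) (χ := fun t => (θ t : k)) f hf

@[simp]
lemma liftB_mB (f : G p → V) (hf : ∀ g (b : B p), f (g * b) = (θ (Bdiag p b) : k) • f g)
    (g : G p) : liftB f hf (mB θ g) = f g :=
  quotLift_of (j := fun b : B p => (b : G p)) (χ := fun b => (θ (Bdiag p b) : k)) f hf g

@[simp]
lemma liftT_mT (f : G p → V) (hf : ∀ g t, f (g * h p t) = (θ t : k) • f g)
    (g : G p) : liftT f hf (mT θ g) = f g :=
  quotLift_of (j := h p) (χ := fun t => (θ t : k)) f hf g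

lemma Mmod_hom_ext {L L' : Mmod p k θ →ₗ[k] V} (hL : ∀ g, L (mB θ g) = L' (mB θ g)) :
    L = L' :=
  quot_hom_ext (j := fun b : B p => (b : G p)) (χ := fun b => (θ (Bdiag p b) : k)) hL

lemma MT_hom_ext {L L' : MT p k θ →ₗ[k] V} (hL : ∀ g, L (mT θ g) = L' (mT θ g)) :
    L = L' :=
  quot_hom_ext (j := h p) (χ := fun t => (θ t : k)) hL

end Induced

section TensorDecomposition

variable {p}

lemma mul_entry (g g' : G p) (i j : Fin 2) :
    (g * g') i j = g i 0 * g' 0 j + g i 1 * g' 1 j := by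
  rw [Matrix.SpecialLinearGroup.coe_mul, Matrix.mul_apply, Fin.sum_univ_two]

lemma inv_entries (g : G p) :
    g⁻¹ 0 0 = g 1 1 ∧ g⁻¹ 0 1 = -g 0 1 ∧ g⁻¹ 1 0 = -g 1 0 ∧ g⁻¹ 1 1 = g 0 0 := by
  simp [Matrix.SpecialLinearGroup.coe_inv, Matrix.adjugate_fin_two]

lemma eps_entries (x : F p) :
    eps p x 0 0 = 1 ∧ eps p x 0 1 = x ∧ eps p x 1 0 = 0 ∧ eps p x 1 1 = 1 := by
  simp [eps]

lemma h_entries (t : (F p)ˣ) :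
    h p t 0 0 = t ∧ h p t 0 1 = 0 ∧ h p t 1 0 = 0 ∧ h p t 1 1 = (t⁻¹ : (F p)ˣ) := by
  simp [h]

lemma sG_entries : sG p 0 0 = 0 ∧ sG p 0 1 = 1 ∧ sG p 1 0 = -1 ∧ sG p 1 1 = 0 := by
  simp [sG]

lemma ext_entries {g g' : G p} (h00 : g 0 0 = g' 0 0) (h01 : g 0 1 = g' 0 1)
    (h10 : g 1 0 = g' 1 0) (h11 : g 1 1 = g' 1 1) : g = g' := by
  ext i j
  fin_cases i <;> fin_cases j <;> assumption

lemma Bdiag_val (b : B p) : (Bdiag p b : F p) = (b : G p) 0 0 := rfl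

lemma Bdiag_inv_val (b : B p) : ((Bdiag p b)⁻¹ : (F p)ˣ) = (b : G p) 1 1 := rfl

lemma B_apply (b : B p) : (b : G p) 1 0 = 0 := b.2

lemma inv_mul_apply_one_zero (b : B p) (w : G p) :
    ((b : G p)⁻¹ * w) 1 0 = Bdiag p b * w 1 0 := by
  simp [mul_entry, inv_entries, B_apply, Bdiag_val]

lemma inv_mul_apply_one_one (b : B p) (w : G p) :
    ((b : G p)⁻¹ * w) 1 1 = Bdiag p b * w 1 1 := by
  simp [mul_entry, inv_entries, B_apply, Bdiag_val]

lemma inv_mul_apply_zero_zero (b : B p) {w : G p} (hw : w 1 0 = 0) :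
    ((b : G p)⁻¹ * w) 0 0 = ((Bdiag p b)⁻¹ : (F p)ˣ) * w 0 0 := by
  simp [mul_entry, inv_entries, hw, Bdiag_inv_val, -Units.val_inv_eq_inv_val]

lemma mul_apply_one_zero (w : G p) (b : B p) :
    (w * (b : G p)) 1 0 = w 1 0 * Bdiag p b := by
  simp [mul_entry, B_apply, Bdiag_val]

lemma mul_apply_zero_zero (w : G p) (b : B p) :
    (w * (b : G p)) 0 0 = w 0 0 * Bdiag p b := by
  simp [mul_entry, B_apply, Bdiag_val]

/-- The element `g` of `G` whose first column is that of `g₂` and whose second column is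
proportional to the first column of `g₁`, provided these two columns are independent. -/
def frame (g₁ g₂ : G p) : G p :=
  g₂ * eps p (-(g₁⁻¹ * g₂) 1 1 / (g₁⁻¹ * g₂) 1 0)

lemma frame_mul_left (g₁ g₂ : G p) (b : B p) : frame (g₁ * (b : G p)) g₂ = frame g₁ g₂ := by
  rw [frame, frame, mul_inv_rev, mul_assoc, inv_mul_apply_one_zero, inv_mul_apply_one_one,
    ← mul_neg, mul_div_mul_left _ _ (Bdiag p b).ne_zero]

lemma frame_mul_right {g₁ g₂ : G p} (hw : (g₁⁻¹ * g₂) 1 0 ≠ 0) (b : B p) :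
    frame g₁ (g₂ * b) = frame g₁ g₂ * h p (Bdiag p b) := by
  rw [frame, frame, ← mul_assoc, mul_assoc g₂, mul_assoc g₂, mul_apply_one_zero]
  generalize g₁⁻¹ * g₂ = w at hw ⊢
  congr 1
  have h10 := B_apply b
  have hinv := Bdiag_inv_val b
  have h0 := (Bdiag p b).ne_zero
  rw [Bdiag_val] at h0
  apply ext_entries <;>
    simp only [mul_entry, eps_entries, h_entries, Bdiag_val, hinv, h10] <;> field_simp <;> ring

lemma frame_smul (g g₁ g₂ : G p) : frame (g * g₁) (g * g₂) = g * frame g₁ g₂ := by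
  simp only [frame, mul_inv_rev, mul_assoc, inv_mul_cancel_left]

lemma frame_mul_weyl_self (g : G p) : frame (g * sG p) g = g := by
  have h1 : (g * sG p)⁻¹ * g = (sG p)⁻¹ := by group
  have h2 : eps p 0 = 1 := by
    apply ext_entries <;> simp [eps_entries]
  simp [frame, h1, h2, inv_entries, sG_entries, -mul_inv_rev]

lemma exists_eq_frame_mul {g₁ g₂ : G p} (hw : (g₁⁻¹ * g₂) 1 0 ≠ 0) :
    ∃ b : B p, (Bdiag p b : F p) = (g₁⁻¹ * g₂) 1 0 ∧ g₁ = frame g₁ g₂ * sG p * b := by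
  obtain ⟨b, hb⟩ : ∃ b, b = (frame g₁ g₂ * sG p)⁻¹ * g₁ := ⟨_, rfl⟩
  have hg : b = (sG p)⁻¹ * ((eps p (-(g₁⁻¹ * g₂) 1 1 / (g₁⁻¹ * g₂) 1 0))⁻¹ *
      (g₁⁻¹ * g₂)⁻¹) := by
    rw [hb, frame]; group
  have hg₁ : g₁ = frame g₁ g₂ * sG p * b := by rw [hb, mul_inv_cancel_left]
  generalize g₁⁻¹ * g₂ = w at hw hg ⊢
  have hbB : b 1 0 = 0 := by
    rw [hg]
    simp only [mul_entry, inv_entries, eps_entries, sG_entries]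
    field_simp
    ring
  refine ⟨⟨b, hbB⟩, ?_, hg₁⟩
  simp only [Bdiag_val, hg, mul_entry, inv_entries, eps_entries, sG_entries]
  ring

variable {k}

omit [IsAlgClosed k] [CharZero k]

variable (lam mu : (F p)ˣ →* kˣ)

/-- The character `λ^s μ` of the torus. -/
abbrev twist : (F p)ˣ →* kˣ := lam.comp (invMonoidHom : (F p)ˣ →* (F p)ˣ) * mu

/-- The function `G × G → M(λμ) ⊕ (kG ⊗_{kT} k_{λ^s μ})` describing the decomposition on pure
tensors of translates of the generators; its two cases are the two `G`-orbits on `G/B × G/B`. -/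
def decompFun (g₁ g₂ : G p) : Mmod p k (lam * mu) × MT p k (twist lam mu) :=
  open scoped Classical in
  if (g₁⁻¹ * g₂) 1 0 = 0 then
    (MulChar.ofUnitHom mu ((g₁⁻¹ * g₂) 0 0) • mB (lam * mu) g₁, 0)
  else (0, MulChar.ofUnitHom lam ((g₁⁻¹ * g₂) 1 0) • mT (twist lam mu) (frame g₁ g₂))

lemma decompFun_smul (g g₁ g₂ : G p) :
    decompFun lam mu (g * g₁) (g * g₂) = γ p k g • decompFun lam mu g₁ g₂ := by
  have : (g * g₁)⁻¹ * (g * g₂) = g₁⁻¹ * g₂ := by group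
  unfold decompFun
  rw [this, frame_smul]
  split_ifs <;> simp [smul_comm (γ p k g), γ_smul_mB, γ_smul_mT]

lemma decompFun_mul_right (g₁ g₂ : G p) (b : B p) :
    decompFun lam mu g₁ (g₂ * b) = (mu (Bdiag p b) : k) • decompFun lam mu g₁ g₂ := by
  unfold decompFun
  rw [← mul_assoc, mul_apply_one_zero, mul_apply_zero_zero]
  by_cases hw : (g₁⁻¹ * g₂) 1 0 = 0
  · simp only [hw, zero_mul, if_true, map_mul, MulChar.ofUnitHom_coe, Prod.smul_mk, smul_zero,
      smul_smul, mul_comm]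
  · rw [if_neg (by simpa using hw), if_neg hw, frame_mul_right hw, mT_mul, map_mul,
      MulChar.ofUnitHom_coe, Prod.smul_mk, smul_zero, smul_smul, smul_smul]
    congr 2
    simp
    field_simp

lemma decompFun_mul_left (g₁ g₂ : G p) (b : B p) :
    decompFun lam mu (g₁ * b) g₂ = (lam (Bdiag p b) : k) • decompFun lam mu g₁ g₂ := by
  unfold decompFun
  rw [frame_mul_left, mul_inv_rev, mul_assoc, inv_mul_apply_one_zero]
  by_cases hw : (g₁⁻¹ * g₂) 1 0 = 0
  · rw [if_pos (by simp [hw]), if_pos hw, inv_mul_apply_zero_zero b hw, map_mul,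
      MulChar.ofUnitHom_coe, mB_mul, Prod.smul_mk, smul_zero, smul_smul, smul_smul]
    congr 2
    simp
    field_simp
  · rw [if_neg (by simpa using hw), if_neg hw, map_mul, MulChar.ofUnitHom_coe, Prod.smul_mk,
      smul_zero, smul_smul]

/-- The decomposition map `M(λ) ⊗ M(μ) → M(λμ) ⊕ (kG ⊗_{kT} k_{λ^s μ})`. -/
def decomp : Mmod p k lam ⊗[k] Mmod p k mu →ₗ[k]
    Mmod p k (lam * mu) × MT p k (twist lam mu) :=
  TensorProduct.lift <| liftB
    (fun g₁ => liftB (decompFun lam mu g₁) (decompFun_mul_right lam mu g₁))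
    (fun g₁ b => Mmod_hom_ext fun g₂ => by simp [decompFun_mul_left])

lemma decomp_tmul (g₁ g₂ : G p) :
    decomp lam mu (mB lam g₁ ⊗ₜ mB mu g₂) = decompFun lam mu g₁ g₂ := by
  simp [decomp]

lemma h_mul_weyl_mem (t : (F p)ˣ) : (sG p)⁻¹ * h p t * sG p ∈ B p := by
  change ((sG p)⁻¹ * h p t * sG p) 1 0 = 0
  simp [mul_entry, inv_entries, h_entries, sG_entries]

lemma mB_h_mul_weyl (θ : (F p)ˣ →* kˣ) (g : G p) (t : (F p)ˣ) :
    mB θ (g * h p t * sG p) = (θ t⁻¹ : k) • mB θ (g * sG p) := by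
  have hd : Bdiag p ⟨_, h_mul_weyl_mem t⟩ = t⁻¹ := by
    ext
    simp [Bdiag_val, mul_entry, inv_entries, h_entries, sG_entries]
  rw [← hd, ← mB_mul]
  congr 1
  group

lemma h_mem (t : (F p)ˣ) : h p t ∈ B p := by
  change (h p t) 1 0 = 0
  simp [h]

lemma mB_h (θ : (F p)ˣ →* kˣ) (g : G p) (t : (F p)ˣ) :
    mB θ (g * h p t) = (θ t : k) • mB θ g := by
  have hd : Bdiag p ⟨_, h_mem t⟩ = t := by
    ext
    simp [Bdiag_val, h]
  conv_rhs => rw [← hd, ← mB_mul]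

/-- The inverse of `decomp`, sending the two generators to `1_λ ⊗ 1_μ` and `s 1_λ ⊗ 1_μ`. -/
def recomp : Mmod p k (lam * mu) × MT p k (twist lam mu) →ₗ[k]
    Mmod p k lam ⊗[k] Mmod p k mu :=
  LinearMap.coprod
    (liftB (fun g => mB lam g ⊗ₜ mB mu g) fun g b => by
      simp only [mB_mul, TensorProduct.smul_tmul_smul]
      simp)
    (liftT (fun g => mB lam (g * sG p) ⊗ₜ mB mu g) fun g t => by
      simp only [mB_h_mul_weyl, mB_h, TensorProduct.smul_tmul_smul]
      simp)

lemma decomp_recomp : decomp lam mu ∘ₗ recomp lam mu = LinearMap.id := by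
  refine LinearMap.prod_ext (Mmod_hom_ext fun g => ?_) (MT_hom_ext fun g => ?_)
  · simp [recomp, decomp_tmul, decompFun, -MulChar.ofUnitHom_eq]
  · have h10 : ((g * sG p)⁻¹ * g) 1 0 = 1 := by
      have : (g * sG p)⁻¹ * g = (sG p)⁻¹ := by group
      simp [this, inv_entries, sG_entries, -mul_inv_rev]
    simp [recomp, decomp_tmul, decompFun, h10, frame_mul_weyl_self, -MulChar.ofUnitHom_eq,
      -mul_inv_rev]

lemma recomp_decompFun (g₁ g₂ : G p) :
    recomp lam mu (decompFun lam mu g₁ g₂) = mB lam g₁ ⊗ₜ mB mu g₂ := by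
  unfold decompFun
  split_ifs with hw
  · have hd : (g₁⁻¹ * g₂) 0 0 = Bdiag p ⟨_, hw⟩ := rfl
    have hg : g₂ = g₁ * (⟨_, hw⟩ : B p) := by simp
    conv_rhs => rw [hg, mB_mul]
    simp [recomp, hd, MulChar.ofUnitHom_coe, -MulChar.ofUnitHom_eq]
  · obtain ⟨b, hb, hg⟩ := exists_eq_frame_mul hw
    have hu : mB mu (frame g₁ g₂) = mB mu g₂ := by
      have hm : eps p (-(g₁⁻¹ * g₂) 1 1 / (g₁⁻¹ * g₂) 1 0) ∈ B p := by
        change eps p _ 1 0 = 0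
        simp [eps]
      have hd : Bdiag p ⟨_, hm⟩ = 1 := by
        ext
        simp [Bdiag_val, eps]
      have := mB_mul (θ := mu) g₂ ⟨_, hm⟩
      rwa [hd, map_one, Units.val_one, one_smul] at this
    conv_rhs => rw [hg, mB_mul, ← hu]
    rw [← hb, MulChar.ofUnitHom_coe]
    simp [recomp, TensorProduct.smul_tmul']

lemma recomp_decomp : recomp lam mu ∘ₗ decomp lam mu = LinearMap.id := by
  refine TensorProduct.ext (Mmod_hom_ext fun g₁ => Mmod_hom_ext fun g₂ => ?_)
  simp [decomp_tmul, recomp_decompFun]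

lemma decomp_equivariant (g : G p) (v : Mmod p k lam ⊗[k] Mmod p k mu) :
    decomp lam mu (TensorProduct.map (gM p k lam g) (gM p k mu g) v) =
      γ p k g • decomp lam mu v := by
  suffices decomp lam mu ∘ₗ TensorProduct.map (gM p k lam g) (gM p k mu g) =
      DistribSMul.toLinearMap k _ (γ p k g) ∘ₗ decomp lam mu from congr($this v)
  refine TensorProduct.ext (Mmod_hom_ext fun g₁ => Mmod_hom_ext fun g₂ => ?_)
  simp [gM_mB, decomp_tmul, decompFun_smul]

end TensorDecomposition

/-- `M(λ) ⊗_k M(μ) ≅ (kG ⊗_{kB} k_{λμ}) ⊕ (kG ⊗_{kT} k_{λ^s μ})`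
as `kG`-modules, where `λ^s(t) = λ(t⁻¹)` and the left-hand side carries the
diagonal `G`-action. -/
theorem stmt19 (hp2 : p ≠ 2) (lam mu : (F p)ˣ →* kˣ) :
    ∃ e : (Mmod p k lam ⊗[k] Mmod p k mu) ≃ₗ[k]
        (Mmod p k (lam * mu) × MT p k (lam.comp (invMonoidHom : (F p)ˣ →* (F p)ˣ) * mu)),
      ∀ (g : G p) (v : Mmod p k lam ⊗[k] Mmod p k mu),
        e (TensorProduct.map (gM p k lam g) (gM p k mu g) v) = γ p k g • e v := by
  exact ⟨LinearEquiv.ofLinearMap (decomp lam mu) (recomp lam mu) (decomp_recomp lam mu)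
    (recomp_decomp lam mu), decomp_equivariant lam mu⟩

end SL2X
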